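/- For any 13 points p₁,…,p₁₃ ∈ ℝP² there exists a nonzero homogeneous polynomial F ∈ ℝ[x₀,x₁,x₂] of degree 4 such that some connected component of the real point set Z(F) contains all thirteen points (i.e. c'(4) ≥ 13). -/

import Mathlib

noncomputable section

/-- The real projective plane, the projectivization of `ℝ³`. -/
abbrev RP2 := Projectivization ℝ (Fin 3 → ℝ)

/-- `ℝP²` carries the quotient topology from `ℝ³ ∖ {0}`. -/
instance : TopologicalSpace RP2 :=
  inferInstanceAs (TopologicalSpace (Quotient (projectivizationSetoid ℝ (Fin 3 → ℝ))))

/-- The real point set of the plane curve defined by `F ∈ ℝ[x₀,x₁,x₂]`; for homogeneous `F`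
this is well defined (independent of the representative). -/
def zeroSet (F : MvPolynomial (Fin 3) ℝ) : Set RP2 :=
  {p | MvPolynomial.eval p.rep F = 0}

/-- The set `S` lies in a single connected component of `Z ⊆ ℝP²` (with the subspace topology):
some connected component of `Z` contains `S`. -/
def inOneComponent (Z S : Set RP2) : Prop :=
  ∃ p ∈ Z, S ⊆ connectedComponentIn Z p

open MvPolynomial in
theorem eval_smul_of_isHomogeneous {σ : Type*} {F : MvPolynomial σ ℝ} {n : ℕ}
    (hF : F.IsHomogeneous n) (c : ℝ) (v : σ → ℝ) :
    eval (c • v) F = c ^ n * eval v F := by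
  rw [eval_eq, eval_eq, Finset.mul_sum]
  refine Finset.sum_congr rfl fun d hd => ?_
  have hdeg : ∑ i ∈ d.support, d i = n := by
    rw [← Finsupp.degree_apply, Finsupp.degree_eq_weight_one]
    exact hF (mem_support_iff.mp hd)
  simp only [Pi.smul_apply, smul_eq_mul, mul_pow, Finset.prod_mul_distrib,
    Finset.prod_pow_eq_pow_sum, hdeg]
  ring

theorem exists_linearIndependent_pair_of_map_eq_zero {K V W : Type*} [Field K] [AddCommGroup V]
    [Module K V] [AddCommGroup W] [Module K W] [FiniteDimensional K V] [FiniteDimensional K W]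
    (f : V →ₗ[K] W) (h : Module.finrank K W + 1 < Module.finrank K V) :
    ∃ x y : V, f x = 0 ∧ f y = 0 ∧ LinearIndependent K ![x, y] := by
  have hker : 1 < Module.finrank K (LinearMap.ker f) := by
    have h₁ := f.finrank_range_add_finrank_ker
    have h₂ := (LinearMap.range f).finrank_le
    omega
  have : Nontrivial (LinearMap.ker f) := Module.nontrivial_of_finrank_pos (R := K) (by omega)
  obtain ⟨x, hx⟩ := exists_ne (0 : LinearMap.ker f)
  obtain ⟨y, hy⟩ := exists_linearIndependent_pair_of_one_lt_finrank hker hx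
  refine ⟨x, y, x.2, y.2, ?_⟩
  rw [LinearIndependent.pair_iff] at hy ⊢
  exact fun s t hst => hy s t (Subtype.ext hst)

/-- There are two linearly independent quartic forms vanishing at any thirteen vectors. -/
theorem exists_quartic_pencil (v : Fin 13 → Fin 3 → ℝ) :
    ∃ F G : MvPolynomial (Fin 3) ℝ, LinearIndependent ℝ ![F, G] ∧
      F.IsHomogeneous 4 ∧ G.IsHomogeneous 4 ∧
      ∀ i, MvPolynomial.eval (v i) F = 0 ∧ MvPolynomial.eval (v i) G = 0 := by
  let s : Set (Fin 3 →₀ ℕ) := ↑((Finset.univ : Finset (Fin 3)).finsuppAntidiag 4)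
  let V := MvPolynomial.restrictSupport ℝ s
  have hcard : Module.finrank ℝ V = 15 := by
    rw [Module.finrank_eq_nat_card_basis (MvPolynomial.basisRestrictSupport ℝ s)]
    simp only [s, Nat.card_eq_fintype_card, Finset.coe_sort_coe, Fintype.card_coe,
      Finset.card_finsuppAntidiag_nat_eq_choose]
    rfl
  have : Module.Finite ℝ V := Module.finite_of_finrank_pos (by omega)
  let ev : V →ₗ[ℝ] (Fin 13 → ℝ) :=
    LinearMap.pi fun i => (MvPolynomial.aeval (v i)).toLinearMap ∘ₗ V.subtype
  obtain ⟨F, G, hF, hG, hFG⟩ := exists_linearIndependent_pair_of_map_eq_zero ev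
    (by rw [hcard, Module.finrank_fin_fun]; norm_num)
  have hhom (P : V) : (P : MvPolynomial (Fin 3) ℝ).IsHomogeneous 4 := by
    intro d hd
    have := P.2 (MvPolynomial.mem_support_iff.mpr hd)
    simp only [s, Finset.mem_coe, Finset.mem_finsuppAntidiag] at this
    change Finsupp.weight (fun _ => 1) d = 4
    rw [← Finsupp.degree_eq_weight_one, Finsupp.degree_eq_sum, this.1]
  have hev {P : V} (hP : ev P = 0) (i : Fin 13) :
      MvPolynomial.eval (v i) (P : MvPolynomial (Fin 3) ℝ) = 0 := by
    simpa [ev, MvPolynomial.aeval_eq_eval] using congrFun hP i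
  refine ⟨F, G, ?_, hhom _, hhom _, fun i => ⟨hev hF i, hev hG i⟩⟩
  rw [LinearIndependent.pair_iff] at hFG ⊢
  exact fun x y h => hFG x y (Subtype.ext h)

theorem not_alternating_quadratic (A B C : ℝ) {m₁ m₂ m₃ m₄ : ℝ} (h₁₂ : m₁ < m₂) (h₂₃ : m₂ < m₃)
    (h₃₄ : m₃ < m₄) (h₁ : 0 < A + B * m₁ + C * m₁ ^ 2) (h₂ : A + B * m₂ + C * m₂ ^ 2 < 0)
    (h₃ : 0 < A + B * m₃ + C * m₃ ^ 2) (h₄ : A + B * m₄ + C * m₄ ^ 2 < 0) : False := by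
  have e₁ : B + C * (m₁ + m₂) < 0 := by nlinarith
  have e₂ : 0 < B + C * (m₂ + m₃) := by nlinarith
  have e₃ : B + C * (m₃ + m₄) < 0 := by nlinarith
  rcases le_total 0 C with hC | hC <;> nlinarith

/-- The restriction of a quartic form to the line spanned by two of its zeros. -/
theorem exists_quadratic_of_eval_eq_zero {σ : Type*} {F : MvPolynomial σ ℝ}
    (hF : F.IsHomogeneous 4) {α β : σ → ℝ} (hα : MvPolynomial.eval α F = 0)
    (hβ : MvPolynomial.eval β F = 0) :
    ∃ A B C : ℝ, ∀ m : ℝ,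
      MvPolynomial.eval (α + m • β) F = m * (A + B * m + C * m ^ 2) := by
  have key (α β : σ → ℝ) : ∃ c : ℕ → ℝ, ∀ m : ℝ,
      MvPolynomial.eval (α + m • β) F = ∑ i ∈ Finset.range 5, c i * m ^ i := by
    let P : Polynomial ℝ :=
      MvPolynomial.aeval (fun i => Polynomial.C (α i) + Polynomial.C (β i) * Polynomial.X) F
    have hP : P.natDegree < 5 := by
      have := MvPolynomial.aeval_natDegree_le F hF.totalDegree_le
        (fun i => Polynomial.C (α i) + Polynomial.C (β i) * Polynomial.X) (n := 1)
        (fun i => by compute_degree)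
      change P.natDegree ≤ _ at this
      omega
    refine ⟨P.coeff, fun m => ?_⟩
    rw [← Polynomial.eval_eq_sum_range' hP]
    have : (Polynomial.aeval m) P = MvPolynomial.aeval (α + m • β) F := by
      simp only [P]
      rw [← AlgHom.comp_apply, MvPolynomial.comp_aeval]
      congr 2
      ext i
      simp [mul_comm m]
    rw [← Polynomial.coe_aeval_eq_eval, this, MvPolynomial.aeval_eq_eval]
  obtain ⟨c, hc⟩ := key α β
  simp only [Finset.sum_range_succ, Finset.sum_range_zero] at hc
  have h₀ : c 0 = 0 := by simpa [hα] using (hc 0).symm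
  have h₄ : c 4 = 0 := by
    have heq : (fun ε : ℝ => MvPolynomial.eval (ε • α + β) F) =
        fun ε => c 0 * ε ^ 4 + c 1 * ε ^ 3 + c 2 * ε ^ 2 + c 3 * ε + c 4 := by
      refine Continuous.ext_on (dense_compl_singleton (0 : ℝ)) ?_ (by fun_prop) fun ε hε => ?_
      · exact (MvPolynomial.continuous_eval F).comp (by fun_prop)
      · have hε : ε ≠ 0 := hε
        have : ε • α + β = ε • (α + ε⁻¹ • β) := by
          rw [smul_add, smul_smul, mul_inv_cancel₀ hε, one_smul]
        simp only [this, eval_smul_of_isHomogeneous hF, hc]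
        field_simp
        ring
    simpa [hβ] using (congrFun heq 0).symm
  refine ⟨c 1, c 2, c 3, fun m => ?_⟩
  rw [hc, h₀, h₄]
  ring

/-- A quartic form vanishing at `α` and `β` cannot change sign from `+` to `-` along both arcs
from `α` to `β` of the line through them. -/
theorem false_of_quartic_sign_changes {σ : Type*} {F : MvPolynomial σ ℝ} (hF : F.IsHomogeneous 4)
    {α β : σ → ℝ} (hα : MvPolynomial.eval α F = 0) (hβ : MvPolynomial.eval β F = 0)
    {s₁ s₂ t₁ t₂ : ℝ} (hs₁ : 0 < s₁) (hs : s₁ < s₂) (hs₂ : s₂ < Real.pi / 2)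
    (ht₁ : 0 < t₁) (ht : t₁ < t₂) (ht₂ : t₂ < Real.pi / 2)
    (h₁ : 0 < MvPolynomial.eval (Real.cos s₁ • α + Real.sin s₁ • β) F)
    (h₂ : MvPolynomial.eval (Real.cos s₂ • α + Real.sin s₂ • β) F < 0)
    (h₃ : 0 < MvPolynomial.eval (Real.cos t₁ • α - Real.sin t₁ • β) F)
    (h₄ : MvPolynomial.eval (Real.cos t₂ • α - Real.sin t₂ • β) F < 0) : False := by
  obtain ⟨A, B, C, hQ⟩ := exists_quadratic_of_eval_eq_zero hF hα hβ
  have hcos {s : ℝ} (h0 : 0 < s) (h1 : s < Real.pi / 2) : 0 < Real.cos s :=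
    Real.cos_pos_of_mem_Ioo ⟨by linarith, h1⟩
  have hplus {s : ℝ} (h : 0 < Real.cos s) :
      MvPolynomial.eval (Real.cos s • α + Real.sin s • β) F = Real.cos s ^ 4 *
        (Real.tan s * (A + B * Real.tan s + C * Real.tan s ^ 2)) := by
    rw [← hQ, ← eval_smul_of_isHomogeneous hF, smul_add, smul_smul, Real.tan_eq_sin_div_cos,
      mul_div_cancel₀ _ h.ne']
  have hminus {s : ℝ} (h : 0 < Real.cos s) :
      MvPolynomial.eval (Real.cos s • α - Real.sin s • β) F = Real.cos s ^ 4 *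
        (-Real.tan s * (A + B * -Real.tan s + C * (-Real.tan s) ^ 2)) := by
    simpa [sub_eq_add_neg] using hplus (s := -s) (by simpa using h)
  have c₁ := hcos hs₁ (hs.trans hs₂)
  have c₂ := hcos (hs₁.trans hs) hs₂
  have c₃ := hcos ht₁ (ht.trans ht₂)
  have c₄ := hcos (ht₁.trans ht) ht₂
  have p₁ := Real.tan_pos_of_pos_of_lt_pi_div_two hs₁ (hs.trans hs₂)
  have p₃ := Real.tan_pos_of_pos_of_lt_pi_div_two ht₁ (ht.trans ht₂)
  have q₁ := Real.tan_lt_tan_of_lt_of_lt_pi_div_two (by linarith [Real.pi_pos]) hs₂ hs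
  have q₃ := Real.tan_lt_tan_of_lt_of_lt_pi_div_two (by linarith [Real.pi_pos]) ht₂ ht
  rw [hplus c₁] at h₁
  rw [hplus c₂] at h₂
  rw [hminus c₃] at h₃
  rw [hminus c₄] at h₄
  have r₁ := pos_of_mul_pos_right (pos_of_mul_pos_right h₁ (by positivity)) p₁.le
  have r₂ := neg_of_mul_neg_right (neg_of_mul_neg_right h₂ (by positivity)) (p₁.trans q₁).le
  have r₃ := neg_of_mul_pos_right (pos_of_mul_pos_right h₃ (by positivity)) (neg_nonpos.mpr p₃.le)
  have r₄ := pos_of_mul_neg_right (neg_of_mul_neg_right h₄ (by positivity))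
    (neg_nonpos.mpr (p₃.trans q₃).le)
  exact not_alternating_quadratic A B C (neg_lt_neg q₃) (by linarith) q₁ r₄ r₃ r₁ r₂

theorem continuous_projectivization_mk {X : Type*} [TopologicalSpace X] {g : X → Fin 3 → ℝ}
    (hg : Continuous g) (h0 : ∀ x, g x ≠ 0) :
    Continuous fun x => (Projectivization.mk ℝ (g x) (h0 x) : RP2) :=
  continuous_quot_mk.comp (hg.subtype_mk h0)

theorem continuous_of_continuous_comp_mk {Y : Type*} [TopologicalSpace Y] {f : RP2 → Y}
    (hf : Continuous fun v : {v : Fin 3 → ℝ // v ≠ 0} => f (Projectivization.mk ℝ v.1 v.2)) :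
    Continuous f :=
  isQuotientMap_quot_mk.continuous_iff.mpr hf

theorem sum_sq_pos_of_ne_zero {ι : Type*} [Fintype ι] {v : ι → ℝ} (hv : v ≠ 0) :
    0 < ∑ i, v i ^ 2 := by
  obtain ⟨i, hi⟩ := Function.ne_iff.mp hv
  exact Finset.sum_pos' (fun _ _ => sq_nonneg _) ⟨i, Finset.mem_univ i, sq_pos_of_ne_zero hi⟩

theorem exists_rep_mk_eq_smul (v : Fin 3 → ℝ) (hv : v ≠ 0) :
    ∃ c : ℝ, c ≠ 0 ∧ (Projectivization.mk ℝ v hv).rep = c • v := by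
  obtain ⟨a, ha⟩ := Projectivization.exists_smul_eq_mk_rep ℝ v hv
  exact ⟨a, a.ne_zero, ha.symm⟩

instance : T2Space RP2 := by
  let m : RP2 → Fin 3 → Fin 3 → ℝ := fun p i j => p.rep i * p.rep j / ∑ k, p.rep k ^ 2
  refine T2Space.of_injective_continuous (f := m) (fun p q hpq => ?_) ?_
  · rw [← p.mk_rep, ← q.mk_rep, Projectivization.mk_eq_mk_iff']
    have hp := sum_sq_pos_of_ne_zero p.rep_nonzero
    have hq := sum_sq_pos_of_ne_zero q.rep_nonzero
    obtain ⟨i, hi⟩ := Function.ne_iff.mp p.rep_nonzero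
    have hi : p.rep i ≠ 0 := hi
    refine ⟨(∑ k, p.rep k ^ 2) / p.rep i * (q.rep i / ∑ k, q.rep k ^ 2), ?_⟩
    ext j
    have := congrFun (congrFun hpq i) j
    simp only [m] at this
    rw [div_eq_div_iff hp.ne' hq.ne'] at this
    simp only [Pi.smul_apply, smul_eq_mul]
    field_simp
    linarith
  · refine continuous_of_continuous_comp_mk ?_
    have : (fun v : {v : Fin 3 → ℝ // v ≠ 0} => m (Projectivization.mk ℝ v.1 v.2)) =
        fun v i j => v.1 i * v.1 j / ∑ k, v.1 k ^ 2 := by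
      ext v i j
      obtain ⟨c, hc, h⟩ := exists_rep_mk_eq_smul v.1 v.2
      have hv := sum_sq_pos_of_ne_zero v.2
      simp only [m, h, Pi.smul_apply, smul_eq_mul, mul_pow, ← Finset.mul_sum]
      field_simp
    rw [this]
    have hc (i : Fin 3) : Continuous fun v : {v : Fin 3 → ℝ // v ≠ 0} => v.1 i :=
      (continuous_apply i).comp continuous_subtype_val
    exact continuous_pi fun i => continuous_pi fun j => ((hc i).mul (hc j)).div
      (continuous_finsetSum _ fun k _ => (hc k).pow 2) fun v => (sum_sq_pos_of_ne_zero v.2).ne'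

/-- The vector representing the point of `ℝP²` attached to a point of the unit disc. -/
def discVec (z : ℂ) : Fin 3 → ℝ := ![z.re, z.im, max 0 (1 - ‖z‖)]

theorem discVec_ne_zero (z : ℂ) : discVec z ≠ 0 := by
  intro h
  have h0 : z.re = 0 := congrFun h 0
  have h1 : z.im = 0 := congrFun h 1
  have h2 : max 0 (1 - ‖z‖) = 0 := congrFun h 2
  have hz : z = 0 := Complex.ext h0 h1
  simp [hz] at h2

theorem continuous_discVec : Continuous discVec := by
  refine continuous_pi fun i => ?_
  fin_cases i
  · exact Complex.continuous_re
  · exact Complex.continuous_im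
  · exact continuous_const.max (continuous_const.sub continuous_norm)

/-- The presentation of `ℝP²` as a quotient of the unit disc. -/
def discMap (z : ℂ) : RP2 := Projectivization.mk ℝ (discVec z) (discVec_ne_zero z)

theorem continuous_discMap : Continuous discMap :=
  continuous_projectivization_mk continuous_discVec discVec_ne_zero

theorem exists_discMap_eq (p : RP2) : ∃ z : ℂ, ‖z‖ ≤ 1 ∧ discMap z = p := by
  induction p using Projectivization.ind with
  | h v hv =>
    let z₀ : ℂ := ⟨v 0, v 1⟩
    have hN : 0 < ‖z₀‖ + |v 2| := by
      by_contra! h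
      have h₁ : z₀ = 0 := norm_le_zero_iff.mp (by linarith [abs_nonneg (v 2)])
      have h₂ : v 2 = 0 := abs_nonpos_iff.mp (by linarith [norm_nonneg z₀])
      refine hv (funext fun i => ?_)
      fin_cases i
      · exact congrArg Complex.re h₁
      · exact congrArg Complex.im h₁
      · exact h₂
    obtain ⟨ε, hε, hεv⟩ : ∃ ε : ℝ, |ε| = 1 ∧ ε * v 2 = |v 2| := by
      rcases le_total 0 (v 2) with h | h
      · exact ⟨1, by simp, by simp [abs_of_nonneg h]⟩
      · exact ⟨-1, by simp, by simp [abs_of_nonpos h]⟩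
    let c : ℝ := ε / (‖z₀‖ + |v 2|)
    have hnorm : ‖(c : ℂ) * z₀‖ = ‖z₀‖ / (‖z₀‖ + |v 2|) := by
      rw [norm_mul, Complex.norm_real, Real.norm_eq_abs, abs_div, hε, abs_of_pos hN]
      ring
    have hle : ‖(c : ℂ) * z₀‖ ≤ 1 := by
      rw [hnorm, div_le_one hN]
      linarith [abs_nonneg (v 2)]
    refine ⟨c * z₀, hle, (Projectivization.mk_eq_mk_iff' ℝ _ _ _ _).mpr ⟨c, ?_⟩⟩
    ext i
    fin_cases i
    · simp [discVec, z₀]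
    · simp [discVec, z₀]
    · change c * v 2 = max 0 (1 - ‖(c : ℂ) * z₀‖)
      rw [max_eq_right (by linarith), hnorm, div_mul_eq_mul_div, hεv]
      field_simp
      ring

theorem eq_or_antipodal_of_discMap_eq {z w : ℂ} (hz : ‖z‖ ≤ 1) (hw : ‖w‖ ≤ 1)
    (h : discMap z = discMap w) : z = w ∨ (‖w‖ = 1 ∧ z = -w) := by
  obtain ⟨c, hc⟩ := (Projectivization.mk_eq_mk_iff' ℝ _ _ _ _).mp h
  have h0 : c * w.re = z.re := congrFun hc 0
  have h1 : c * w.im = z.im := congrFun hc 1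
  have h2 : c * max 0 (1 - ‖w‖) = max 0 (1 - ‖z‖) := congrFun hc 2
  rw [max_eq_right (by linarith), max_eq_right (by linarith)] at h2
  have hzw : z = c * w := by apply Complex.ext <;> simp [h0, h1]
  have hn : ‖z‖ = |c| * ‖w‖ := by rw [hzw, norm_mul, Complex.norm_real, Real.norm_eq_abs]
  rcases le_or_gt 0 c with hc0 | hc0
  · left
    rw [abs_of_nonneg hc0] at hn
    have : c = 1 := by linarith
    simp [hzw, this]
  · right
    rw [abs_of_neg hc0] at hn
    have hw1 : ‖w‖ = 1 := by nlinarith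
    have : c = -1 := by rw [hw1] at h2 hn; linarith
    exact ⟨hw1, by simp [hzw, this]⟩

/-- The restriction of `discMap` to the closed unit disc. -/
def closedDiscMap (z : Metric.closedBall (0 : ℂ) 1) : RP2 := discMap z

theorem surjective_closedDiscMap : Function.Surjective closedDiscMap := fun p => by
  obtain ⟨z, hz, h⟩ := exists_discMap_eq p
  exact ⟨⟨z, by simpa using hz⟩, h⟩

theorem continuous_closedDiscMap : Continuous closedDiscMap :=
  continuous_discMap.comp continuous_subtype_val

instance : CompactSpace (Metric.closedBall (0 : ℂ) 1) :=
  isCompact_iff_compactSpace.mp (isCompact_closedBall 0 1)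

instance : CompactSpace RP2 :=
  surjective_closedDiscMap.compactSpace continuous_closedDiscMap

/-- Every nowhere vanishing complex function on `ℝP²` has a continuous argument. -/
theorem exists_continuous_arg {g : RP2 → ℂ} (hg : Continuous g) (hg0 : ∀ x, g x ≠ 0) :
    ∃ φ : RP2 → ℝ, Continuous φ ∧
      ∀ x, (g x).re = ‖g x‖ * Real.cos (φ x) ∧ (g x).im = ‖g x‖ * Real.sin (φ x) := by
  obtain ⟨H, ⟨-, hH⟩, -⟩ := Complex.isCoveringMapOn_exp.existsUnique_continuousMap_lifts
    (⟨fun z => g (discMap z), hg.comp continuous_discMap⟩ : C(ℂ, ℂ)) (a₀ := 0)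
    (e₀ := Complex.log (g (discMap 0))) (by simp [Complex.exp_log (hg0 _)]) (fun z => hg0 _)
  have hH (z : ℂ) : Complex.exp (H z) = g (discMap z) := congrFun hH z
  have hanti (w : ℂ) (hw : ‖w‖ = 1) : (H (-w)).im = (H w).im := by
    let k : ℝ → ℝ := fun θ => (H (-Complex.exp (θ * Complex.I))).im
      - (H (Complex.exp (θ * Complex.I))).im
    have hk : Continuous k := by fun_prop
    have hkint (θ : ℝ) : k θ ∈ AddSubgroup.zmultiples (2 * Real.pi) := by
      have hd : discMap (-Complex.exp (θ * Complex.I)) = discMap (Complex.exp (θ * Complex.I)) := by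
        refine (Projectivization.mk_eq_mk_iff' ℝ _ _ _ _).mpr ⟨-1, ?_⟩
        ext i
        fin_cases i <;> simp [discVec, Complex.norm_exp_ofReal_mul_I]
      have := (hH (-Complex.exp (θ * Complex.I))).trans ((congrArg g hd).trans (hH _).symm)
      obtain ⟨n, hn⟩ := Complex.exp_eq_exp_iff_exists_int.mp this
      refine AddSubgroup.mem_zmultiples_iff.mpr ⟨n, ?_⟩
      simp only [k, hn]
      simp
    have hconst (θ θ' : ℝ) : k θ = k θ' := by
      have : DiscreteTopology (AddSubgroup.zmultiples (2 * Real.pi)) :=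
        NormedSpace.discreteTopology_zmultiples _
      exact congrArg Subtype.val
        (PreconnectedSpace.constant (f := fun θ => (⟨k θ, hkint θ⟩ : AddSubgroup.zmultiples _))
          inferInstance (hk.subtype_mk hkint) (x := θ) (y := θ'))
    have hodd (θ : ℝ) : k (θ + Real.pi) = -k θ := by
      simp [k, add_mul, Complex.exp_add]
    have hwarg : Complex.exp (w.arg * Complex.I) = w := by
      simpa [hw] using Complex.norm_mul_exp_arg_mul_I w
    have h₁ := hconst (w.arg + Real.pi) w.arg
    rw [hodd] at h₁
    have h₂ : k w.arg = (H (-w)).im - (H w).im := by simp only [k, hwarg]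
    linarith
  have hq : Topology.IsQuotientMap closedDiscMap :=
    continuous_closedDiscMap.isClosedMap.isQuotientMap continuous_closedDiscMap
      surjective_closedDiscMap
  have hfib (z w : Metric.closedBall (0 : ℂ) 1) (h : closedDiscMap z = closedDiscMap w) :
      (H z).im = (H w).im := by
    rcases eq_or_antipodal_of_discMap_eq (mem_closedBall_zero_iff.mp z.2)
      (mem_closedBall_zero_iff.mp w.2) h with h | ⟨hw, h⟩
    · rw [h]
    · rw [h, hanti _ hw]
  let φ : RP2 → ℝ := fun x =>
    (H (Function.surjInv surjective_closedDiscMap x : Metric.closedBall (0 : ℂ) 1)).im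
  have hφ (z : Metric.closedBall (0 : ℂ) 1) : φ (closedDiscMap z) = (H z).im :=
    hfib _ _ (Function.surjInv_eq _ _)
  refine ⟨φ, hq.continuous_iff.mpr ?_, fun x => ?_⟩
  · rw [show φ ∘ closedDiscMap = fun z : Metric.closedBall (0 : ℂ) 1 => (H z).im from funext hφ]
    fun_prop
  obtain ⟨z, rfl⟩ := surjective_closedDiscMap x
  have hz : g (closedDiscMap z) = Complex.exp (H z) := (hH z).symm
  rw [hφ, hz, Complex.norm_exp, Complex.exp_re, Complex.exp_im]
  exact ⟨rfl, rfl⟩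

/-- The continuous function on `ℝP²` with the signs of a quartic form. -/
def quarticFun (F : MvPolynomial (Fin 3) ℝ) (p : RP2) : ℝ :=
  MvPolynomial.eval p.rep F / (∑ i, p.rep i ^ 2) ^ 2

theorem quarticFun_mk {F : MvPolynomial (Fin 3) ℝ} (hF : F.IsHomogeneous 4) (v : Fin 3 → ℝ)
    (hv : v ≠ 0) :
    quarticFun F (Projectivization.mk ℝ v hv) = MvPolynomial.eval v F / (∑ i, v i ^ 2) ^ 2 := by
  obtain ⟨c, hc, h⟩ := exists_rep_mk_eq_smul v hv
  have := sum_sq_pos_of_ne_zero hv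
  simp only [quarticFun, h, eval_smul_of_isHomogeneous hF, Pi.smul_apply, smul_eq_mul, mul_pow,
    ← Finset.mul_sum]
  field_simp

theorem quarticFun_mk_pos_iff {F : MvPolynomial (Fin 3) ℝ} (hF : F.IsHomogeneous 4)
    {v : Fin 3 → ℝ} (hv : v ≠ 0) :
    0 < quarticFun F (Projectivization.mk ℝ v hv) ↔ 0 < MvPolynomial.eval v F := by
  have := sum_sq_pos_of_ne_zero hv
  rw [quarticFun_mk hF, div_pos_iff_of_pos_right (by positivity)]

theorem quarticFun_neg (F : MvPolynomial (Fin 3) ℝ) : quarticFun (-F) = -quarticFun F := by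
  ext p
  simp [quarticFun, neg_div]

theorem quarticFun_mk_neg_iff {F : MvPolynomial (Fin 3) ℝ} (hF : F.IsHomogeneous 4)
    {v : Fin 3 → ℝ} (hv : v ≠ 0) :
    quarticFun F (Projectivization.mk ℝ v hv) < 0 ↔ MvPolynomial.eval v F < 0 := by
  simpa [quarticFun_neg] using quarticFun_mk_pos_iff hF.neg hv

theorem quarticFun_eq_zero_iff (F : MvPolynomial (Fin 3) ℝ) (p : RP2) :
    quarticFun F p = 0 ↔ MvPolynomial.eval p.rep F = 0 := by
  have := sum_sq_pos_of_ne_zero p.rep_nonzero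
  simp [quarticFun, this.ne']

theorem continuous_quarticFun {F : MvPolynomial (Fin 3) ℝ} (hF : F.IsHomogeneous 4) :
    Continuous (quarticFun F) := by
  refine continuous_of_continuous_comp_mk ?_
  simp only [quarticFun_mk hF]
  have hc (i : Fin 3) : Continuous fun v : {v : Fin 3 → ℝ // v ≠ 0} => v.1 i :=
    (continuous_apply i).comp continuous_subtype_val
  exact ((MvPolynomial.continuous_eval F).comp continuous_subtype_val).div
    ((continuous_finsetSum _ fun k _ => (hc k).pow 2).pow 2)
    fun v => (pow_pos (sum_sq_pos_of_ne_zero v.2) 2).ne'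

/-- Two points of `S` are separated by the positivity set of `f`, as witnessed by a continuous
function changing sign between them whose zeros lie in that positivity set. -/
def SeparatedByPos (S : Set RP2) (f : RP2 → ℝ) : Prop :=
  ∃ u : RP2 → ℝ, Continuous u ∧ (∀ x, u x = 0 → 0 < f x) ∧ ∃ a ∈ S, ∃ b ∈ S, u a < 0 ∧ 0 < u b

theorem exists_continuous_separating {Z S : Set RP2} (hZ : IsClosed Z) (hS : S.Nonempty)
    (hSZ : S ⊆ Z) (h : ¬ inOneComponent Z S) :
    ∃ u : RP2 → ℝ, Continuous u ∧ (∀ x ∈ Z, u x ≠ 0) ∧ ∃ a ∈ S, ∃ b ∈ S, u a < 0 ∧ 0 < u b := by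
  obtain ⟨a, ha⟩ := hS
  obtain ⟨b, hb, hab⟩ : ∃ b ∈ S, b ∉ connectedComponentIn Z a := by
    by_contra! hall
    exact h ⟨a, hSZ ha, hall⟩
  have : CompactSpace Z := isCompact_iff_compactSpace.mp hZ.isCompact
  rw [connectedComponentIn_eq_image (hSZ ha)] at hab
  have hab' : (⟨b, hSZ hb⟩ : Z) ∉ connectedComponent (⟨a, hSZ ha⟩ : Z) :=
    fun hmem => hab ⟨_, hmem, rfl⟩
  simp only [connectedComponent_eq_iInter_isClopen, Set.mem_iInter, not_forall] at hab'
  obtain ⟨⟨C, hC, haC⟩, hbC⟩ := hab'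
  obtain ⟨θ, h0, h1, -⟩ := exists_continuous_zero_one_of_isClosed
    (hZ.isClosedMap_subtype_val _ hC.isClosed) (hZ.isClosedMap_subtype_val _ hC.compl.isClosed)
    ((Set.disjoint_image_iff Subtype.val_injective).mpr disjoint_compl_right)
  refine ⟨fun x => θ x - 1 / 2, by fun_prop, fun x hx => ?_, a, ha, b, hb, ?_, ?_⟩
  · by_cases hxC : (⟨x, hx⟩ : Z) ∈ C
    · have := h0 ⟨_, hxC, rfl⟩
      simp only [Pi.zero_apply] at this
      norm_num [this]
    · have := h1 ⟨_, hxC, rfl⟩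
      simp only [Pi.one_apply] at this
      norm_num [this]
  · have := h0 ⟨_, haC, rfl⟩
    simp only [Pi.zero_apply] at this
    norm_num [this]
  · have := h1 ⟨_, hbC, rfl⟩
    simp only [Pi.one_apply] at this
    norm_num [this]

theorem separatedByPos_or_neg {S : Set RP2} {f : RP2 → ℝ} (hf : Continuous f) (hS : S.Nonempty)
    (hSf : ∀ x ∈ S, f x = 0) (h : ¬ inOneComponent {x | f x = 0} S) :
    SeparatedByPos S f ∨ SeparatedByPos S (-f) := by
  obtain ⟨u, hu, huf, a, ha, b, hb, hua, hub⟩ :=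
    exists_continuous_separating (isClosed_eq hf continuous_const) hS hSf h
  have hg0 (x : RP2) : (⟨u x, f x⟩ : ℂ) ≠ 0 := fun hx =>
    huf x (congrArg Complex.im hx) (congrArg Complex.re hx)
  have hg : Continuous fun x => (⟨u x, f x⟩ : ℂ) :=
    Complex.equivRealProdCLM.symm.continuous.comp (hu.prodMk hf)
  obtain ⟨φ, hφ, hφg⟩ := exists_continuous_arg hg hg0
  have hpos (x : RP2) : 0 < ‖(⟨u x, f x⟩ : ℂ)‖ := norm_pos_iff.mpr (hg0 x)
  have hcos (x : RP2) : u x = ‖(⟨u x, f x⟩ : ℂ)‖ * Real.cos (φ x) := (hφg x).1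
  have hsin (x : RP2) : f x = ‖(⟨u x, f x⟩ : ℂ)‖ * Real.sin (φ x) := (hφg x).2
  have hsin0 (x : RP2) (hx : x ∈ S) : Real.sin (φ x) = 0 := by
    have := hsin x
    rw [hSf x hx] at this
    exact (mul_eq_zero.mp this.symm).resolve_left (hSf x hx ▸ hpos x).ne'
  have hcosa : Real.cos (φ a) < 0 := neg_of_mul_neg_right (hcos a ▸ hua) (hpos a).le
  have hcosb : 0 < Real.cos (φ b) := pos_of_mul_pos_right (hcos b ▸ hub) (hpos b).le
  obtain ⟨n, hn⟩ := Real.sin_eq_zero_iff.mp (hsin0 a ha)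
  obtain ⟨m, hm⟩ := Real.sin_eq_zero_iff.mp (hsin0 b hb)
  have hπ := Real.pi_pos
  rcases lt_trichotomy n m with hnm | hnm | hnm
  · right
    have hnm : (n : ℝ) + 1 ≤ m := by exact_mod_cast hnm
    refine ⟨fun x => φ x - (φ a + Real.pi / 2), by fun_prop, fun x hx => ?_, a, ha, b, hb, ?_, ?_⟩
    · rw [Pi.neg_apply, hsin x, sub_eq_zero.mp hx, Real.sin_add_pi_div_two]
      nlinarith [hpos x]
    · linarith
    · nlinarith
  · rw [← hm, ← hnm, hn] at hcosb
    linarith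
  · left
    have hnm : (m : ℝ) + 1 ≤ n := by exact_mod_cast hnm
    refine ⟨fun x => (φ a - Real.pi / 2) - φ x, by fun_prop, fun x hx => ?_, a, ha, b, hb, ?_, ?_⟩
    · rw [hsin x, ← sub_eq_zero.mp hx, Real.sin_sub_pi_div_two]
      nlinarith [hpos x]
    · linarith
    · nlinarith

/-- A continuous function rising past `c₁ < c₂` attains `c₁` and later `c₂`. -/
theorem exists_crossings {h : ℝ → ℝ} (hh : Continuous h) {l c₁ c₂ : ℝ} (hl : 0 < l)
    (h0 : h 0 < c₁) (hc : c₁ < c₂) (h1 : c₂ < h l) :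
    ∃ s₁ s₂, 0 < s₁ ∧ s₁ < s₂ ∧ s₂ < l ∧ h s₁ = c₁ ∧ h s₂ = c₂ := by
  obtain ⟨s₂, hs₂, e₂⟩ := intermediate_value_Ioo hl.le hh.continuousOn ⟨h0.trans hc, h1⟩
  obtain ⟨s₁, hs₁, e₁⟩ := intermediate_value_Ioo hs₂.1.le hh.continuousOn ⟨h0, e₂ ▸ hc⟩
  exact ⟨s₁, s₂, hs₁.1, hs₁.2, hs₂.2, e₁, e₂⟩

/-- The signs of a quartic form cannot follow the level sets of a continuous function whose
values at two zeros of the form lie on different sides. -/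
theorem false_of_level_signs {F : MvPolynomial (Fin 3) ℝ} (hF : F.IsHomogeneous 4)
    {ψ : RP2 → ℝ} (hψ : Continuous ψ) {a b : RP2} (ha : quarticFun F a = 0)
    (hb : quarticFun F b = 0) {c₁ c₂ : ℝ} (hac : ψ a < c₁) (hc : c₁ < c₂) (hcb : c₂ < ψ b)
    (h₁ : ∀ x, ψ x = c₁ → 0 < quarticFun F x) (h₂ : ∀ x, ψ x = c₂ → quarticFun F x < 0) :
    False := by
  have hab : a ≠ b := by
    rintro rfl
    linarith
  have hind := LinearIndependent.pair_iff.mp (Projectivization.linearIndependent_pair_iff_ne.mpr hab)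
  have hline (β : Fin 3 → ℝ) (hβ : β ≠ 0) (hβb : Projectivization.mk ℝ β hβ = b)
      (hind : ∀ s t : ℝ, s • a.rep + t • β = 0 → s = 0 ∧ t = 0) :
      ∃ s₁ s₂, 0 < s₁ ∧ s₁ < s₂ ∧ s₂ < Real.pi / 2 ∧
        0 < MvPolynomial.eval (Real.cos s₁ • a.rep + Real.sin s₁ • β) F ∧
        MvPolynomial.eval (Real.cos s₂ • a.rep + Real.sin s₂ • β) F < 0 := by
    have hne (s : ℝ) : Real.cos s • a.rep + Real.sin s • β ≠ 0 := fun h => by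
      obtain ⟨h₁, h₂⟩ := hind _ _ h
      simpa [h₁, h₂] using Real.sin_sq_add_cos_sq s
    obtain ⟨s₁, s₂, hs₁, hs, hs₂, e₁, e₂⟩ := exists_crossings
      (hψ.comp (continuous_projectivization_mk (by fun_prop) hne)) (half_pos Real.pi_pos)
      (c₁ := c₁) (c₂ := c₂) (by simpa using hac) hc (by simpa [hβb] using hcb)
    exact ⟨s₁, s₂, hs₁, hs, hs₂, (quarticFun_mk_pos_iff hF _).mp (h₁ _ e₁),
      (quarticFun_mk_neg_iff hF _).mp (h₂ _ e₂)⟩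
  obtain ⟨s₁, s₂, hs₁, hs, hs₂, p₁, p₂⟩ := hline b.rep b.rep_nonzero b.mk_rep hind
  obtain ⟨t₁, t₂, ht₁, ht, ht₂, q₁, q₂⟩ := hline (-b.rep) (neg_ne_zero.mpr b.rep_nonzero)
    (by
      conv_rhs => rw [← b.mk_rep]
      exact (Projectivization.mk_eq_mk_iff' ℝ _ _ _ _).mpr ⟨-1, by simp⟩)
    (fun s t h => by simpa using hind s (-t) (by simpa using h))
  simp only [smul_neg, ← sub_eq_add_neg] at q₁ q₂
  exact false_of_quartic_sign_changes hF ((quarticFun_eq_zero_iff F a).mp ha)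
    ((quarticFun_eq_zero_iff F b).mp hb) hs₁ hs hs₂ ht₁ ht ht₂ p₁ p₂ q₁ q₂

theorem false_of_separating_pair {F : MvPolynomial (Fin 3) ℝ} (hF : F.IsHomogeneous 4)
    {u v : RP2 → ℝ} (hu : Continuous u) (hv : Continuous v)
    (huF : ∀ x, u x = 0 → 0 < quarticFun F x) (hvF : ∀ x, v x = 0 → quarticFun F x < 0)
    {a b : RP2} (ha : quarticFun F a = 0) (hb : quarticFun F b = 0)
    (hua : u a < 0) (hub : 0 < u b) (hva : v a < 0) (hvb : 0 < v b) : False := by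
  have hg0 (x : RP2) : (⟨u x, v x⟩ : ℂ) ≠ 0 := fun hx =>
    (huF x (congrArg Complex.re hx)).not_gt (hvF x (congrArg Complex.im hx))
  have hg : Continuous fun x => (⟨u x, v x⟩ : ℂ) :=
    Complex.equivRealProdCLM.symm.continuous.comp (hu.prodMk hv)
  obtain ⟨φ, hφ, hφg⟩ := exists_continuous_arg hg hg0
  let k : ℤ := ⌊φ a / (2 * Real.pi)⌋
  let ψ : RP2 → ℝ := fun x => φ x - k * (2 * Real.pi)
  have hψ : Continuous ψ := by fun_prop
  have hpos (x : RP2) : 0 < ‖(⟨u x, v x⟩ : ℂ)‖ := norm_pos_iff.mpr (hg0 x)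
  have hcos (x : RP2) : u x = ‖(⟨u x, v x⟩ : ℂ)‖ * Real.cos (ψ x) := by
    simpa only [ψ, Real.cos_sub_int_mul_two_pi] using (hφg x).1
  have hsin (x : RP2) : v x = ‖(⟨u x, v x⟩ : ℂ)‖ * Real.sin (ψ x) := by
    simpa only [ψ, Real.sin_sub_int_mul_two_pi] using (hφg x).2
  have hcosF (x : RP2) (hx : Real.cos (ψ x) = 0) : 0 < quarticFun F x :=
    huF x (by rw [hcos, hx, mul_zero])
  have hsinF (x : RP2) (hx : Real.sin (ψ x) = 0) : quarticFun F x < 0 :=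
    hvF x (by rw [hsin, hx, mul_zero])
  have hcosa : Real.cos (ψ a) < 0 := neg_of_mul_neg_right (hcos a ▸ hua) (hpos a).le
  have hcosb : 0 < Real.cos (ψ b) := pos_of_mul_pos_right (hcos b ▸ hub) (hpos b).le
  have hsina : Real.sin (ψ a) < 0 := neg_of_mul_neg_right (hsin a ▸ hva) (hpos a).le
  have hsinb : 0 < Real.sin (ψ b) := pos_of_mul_pos_right (hsin b ▸ hvb) (hpos b).le
  have hπ := Real.pi_pos
  have ha0 : 0 ≤ ψ a := by
    have := Int.floor_le (φ a / (2 * Real.pi))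
    rw [le_div_iff₀ (by positivity)] at this
    linarith
  have ha2 : ψ a < 2 * Real.pi := by
    have := Int.lt_floor_add_one (φ a / (2 * Real.pi))
    rw [div_lt_iff₀ (by positivity)] at this
    linarith
  have ha1 : Real.pi < ψ a := by
    by_contra! h
    linarith [Real.sin_nonneg_of_nonneg_of_le_pi ha0 h]
  have ha3 : ψ a < 3 * Real.pi / 2 := by
    by_contra! h
    have := Real.cos_nonneg_of_neg_pi_div_two_le_of_le (x := ψ a - 2 * Real.pi)
      (by linarith) (by linarith)
    rw [Real.cos_sub_two_pi] at this
    linarith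
  rcases lt_or_ge (2 * Real.pi) (ψ b) with hb2 | hb2
  · refine false_of_level_signs hF hψ ha hb ha3 (by linarith) hb2
      (fun x hx => hcosF x ?_) fun x hx => hsinF x (by rw [hx, Real.sin_two_pi])
    rw [hx, show 3 * Real.pi / 2 = Real.pi / 2 + Real.pi by ring, Real.cos_add_pi,
      Real.cos_pi_div_two, neg_zero]
  · have hb1 : ψ b < Real.pi := by
      by_contra! h
      have := Real.sin_nonpos_of_nonpos_of_neg_pi_le (x := ψ b - 2 * Real.pi)
        (by linarith) (by linarith)
      rw [Real.sin_sub_two_pi] at this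
      linarith
    have hb0 : ψ b < Real.pi / 2 := by
      by_contra! h
      linarith [Real.cos_nonpos_of_pi_div_two_le_of_le h (by linarith)]
    refine false_of_level_signs hF.neg (ψ := fun x => -ψ x) hψ.neg (c₁ := -Real.pi)
      (c₂ := -(Real.pi / 2)) (by simpa [quarticFun_neg] using ha)
      (by simpa [quarticFun_neg] using hb) (by linarith) (by linarith) (by linarith)
      (fun x hx => ?_) fun x hx => ?_
    · simpa [quarticFun_neg] using hsinF x (by rw [neg_inj.mp hx, Real.sin_pi])
    · simpa [quarticFun_neg] using hcosF x (by rw [neg_inj.mp hx, Real.cos_pi_div_two])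

theorem not_separatedByPos_and_neg {F : MvPolynomial (Fin 3) ℝ} (hF : F.IsHomogeneous 4)
    {S : Set RP2} (hS : ∀ x ∈ S, quarticFun F x = 0) :
    ¬ (SeparatedByPos S (quarticFun F) ∧ SeparatedByPos S (-quarticFun F)) := by
  rintro ⟨⟨u, hu, huF, a, ha, b, hb, hua, hub⟩, v, hv, hvF, c, hc, d, hd, hvc, hvd⟩
  have hvF' (x : RP2) (hx : v x = 0) : quarticFun F x < 0 := neg_pos.mp (hvF x hx)
  have hnvF (x : RP2) (hx : -v x = 0) : quarticFun F x < 0 := hvF' x (neg_eq_zero.mp hx)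
  have hpair {x y : RP2} (hx : x ∈ S) (hy : y ∈ S) (hux : u x < 0) (huy : 0 < u y) :
      0 < v x * v y := by
    have hx0 := hS x hx
    have hy0 := hS y hy
    have hvx : v x ≠ 0 := fun h => (hvF' x h).ne hx0
    have hvy : v y ≠ 0 := fun h => (hvF' y h).ne hy0
    rcases hvx.lt_or_gt with h | h <;> rcases hvy.lt_or_gt with h' | h'
    · exact mul_pos_of_neg_of_neg h h'
    · exact (false_of_separating_pair hF hu hv huF hvF' hx0 hy0 hux huy h h').elim
    · exact (false_of_separating_pair hF hu hv.neg huF hnvF hx0 hy0 hux huy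
        (neg_neg_of_pos h) (neg_pos_of_neg h')).elim
    · exact mul_pos h h'
  have hsign {x : RP2} (hx : x ∈ S) : 0 < v x * v a := by
    have hab := hpair ha hb hua hub
    rcases lt_trichotomy (u x) 0 with h | h | h
    · have hxb := hpair hx hb h hub
      by_contra! hneg
      nlinarith [mul_pos hab hxb, mul_nonneg (neg_nonneg.mpr hneg) (sq_nonneg (v b))]
    · exact absurd (hS x hx) (huF x h).ne'
    · linarith [hpair ha hx hua h, mul_comm (v x) (v a)]
  nlinarith [mul_pos (hsign hc) (hsign hd),
    mul_nonneg (mul_pos (neg_pos.mpr hvc) hvd).le (sq_nonneg (v a))]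

theorem isOpen_setOf_separatedByPos (S : Set RP2) {f : ℝ → RP2 → ℝ}
    (hf : Continuous fun z : ℝ × RP2 => f z.1 z.2) : IsOpen {t | SeparatedByPos S (f t)} := by
  rw [isOpen_iff_mem_nhds]
  rintro t ⟨u, hu, huf, hS⟩
  have hK : IsCompact {x | u x = 0} := (isClosed_eq hu continuous_const).isCompact
  have := hK.eventually_forall_of_forall_eventually (x₀ := t) (P := fun t x => 0 < f t x)
    fun x hx => hf.continuousAt.eventually_const_lt (huf x hx)
  filter_upwards [this] with s hs using ⟨u, hu, hs, hS⟩

/-- Through any 13 points of `ℝP²` one can trace a connected component of the real point set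
of a real curve of degree 4 (i.e. `c'(4) ≥ 13`). -/
theorem stmt_7 (p : Fin 13 → RP2) :
    ∃ F : MvPolynomial (Fin 3) ℝ, F ≠ 0 ∧ F.IsHomogeneous 4 ∧
      inOneComponent (zeroSet F) (Set.range p) := by
  obtain ⟨F, G, hFG, hF, hG, hp⟩ := exists_quartic_pencil fun i => (p i).rep
  let H : ℝ → MvPolynomial (Fin 3) ℝ := fun t =>
    MvPolynomial.C (Real.cos t) * F + MvPolynomial.C (Real.sin t) * G
  have hH (t : ℝ) : (H t).IsHomogeneous 4 := (hF.C_mul _).add (hG.C_mul _)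
  have hH0 (t : ℝ) : H t ≠ 0 := fun h => by
    obtain ⟨h₁, h₂⟩ := LinearIndependent.pair_iff.mp hFG (Real.cos t) (Real.sin t)
      (by simpa only [H, MvPolynomial.C_mul'] using h)
    simpa [h₁, h₂] using Real.sin_sq_add_cos_sq t
  have hfun (t : ℝ) (x : RP2) : quarticFun (H t) x =
      Real.cos t * quarticFun F x + Real.sin t * quarticFun G x := by
    simp only [quarticFun, H, map_add, map_mul, MvPolynomial.eval_C]
    ring
  have hpz (t : ℝ) : ∀ x ∈ Set.range p, quarticFun (H t) x = 0 := by
    rintro _ ⟨i, rfl⟩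
    rw [hfun, (quarticFun_eq_zero_iff F _).mpr (hp i).1, (quarticFun_eq_zero_iff G _).mpr (hp i).2]
    ring
  by_contra! hcon
  let f : ℝ → RP2 → ℝ := fun t => quarticFun (H t)
  have hcover (t : ℝ) : SeparatedByPos (Set.range p) (f t) ∨ SeparatedByPos (Set.range p) (-f t) :=
    separatedByPos_or_neg (continuous_quarticFun (hH t)) (Set.range_nonempty p) (hpz t) (by
      simpa only [f, zeroSet, quarticFun_eq_zero_iff] using hcon (H t) (hH0 t) (hH t))
  have hshift (t : ℝ) : f (t + Real.pi) = -f t := by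
    ext x
    simp only [f, Pi.neg_apply, hfun, Real.cos_add_pi, Real.sin_add_pi]
    ring
  have hfc : Continuous fun z : ℝ × RP2 => f z.1 z.2 := by
    have hFc := continuous_quarticFun hF
    have hGc := continuous_quarticFun hG
    simp only [f, hfun]
    fun_prop
  obtain ⟨t, ht⟩ : ∃ t, SeparatedByPos (Set.range p) (f t) := by
    rcases hcover 0 with h | h
    · exact ⟨_, h⟩
    · exact ⟨0 + Real.pi, by rwa [hshift]⟩
  obtain ⟨s, -, hs₁, hs₂⟩ := isPreconnected_univ (α := ℝ) _ _
    (isOpen_setOf_separatedByPos (Set.range p) hfc)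
    (isOpen_setOf_separatedByPos (Set.range p) (f := fun t => -f t) hfc.neg)
    (fun s _ => hcover s) ⟨t, trivial, ht⟩
    ⟨t + Real.pi, trivial, by simpa [hshift] using ht⟩
  exact not_separatedByPos_and_neg (hH s) (hpz s) ⟨hs₁, hs₂⟩
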